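/- The short exact sequence 0 → Ω⊗ℝ[u] →^{π'} C →^{∮'} G[−1]⊗ℝ[u] → 0 induces a long exact sequence ⋯ → [H(Ω)⊗ℝ[u]]^i →^{π'} H^i(C) →^{∮'} [H(G)⊗ℝ[u]]^{i−1} →^{δ} [H(Ω)⊗ℝ[u]]^{i+1} → ⋯ (where [H(Ω)⊗ℝ[u]]^m = ⊕_{j≥0} H^{m−2j}(Ω)⊗ℝ·u^j and similarly for G), in which the connecting homomorphism is given, for a cocycle β ∈ G^{i−1−2j} and any α ∈ P^{i−2j} with dα + (−1)^{i−1}β∧ε ∈ P^{i+1−2j}, by δ([β]⊗u^j) = [dα + (−1)^{i−1} β∧ε]⊗u^j + (−1)^{i−1} ι̃[β]⊗u^{j+1}; that is, δ = 𝕖⊗1 ± ι̃⊗u. -/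

import Mathlib

/-!
Common algebraic model for the paper "Intersection cohomology of circle actions"
(Padilla–Saralegi), following the CONTEXT of the statements.

`A` models the (total space of the) graded-commutative differential graded ℝ-algebra
`A = ⊕ₙ Aⁿ` of liftable forms on the orbit space `B`; the grading is only recorded
through the families of graded subspaces `P Q : ℤ → Submodule ℝ A` (the forms of
perverse degree `≤ p̄` resp. `≤ p̄ - x̄`), which vanish in negative degrees
(`Aⁿ = 0` for `n < 0`).  The differential is `d` with `d ∘ d = 0`, and
`e : A →ₗ[ℝ] A` is right multiplication by the fixed Euler form `ε ∈ A²`;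
the hypotheses `dε = 0` together with the graded Leibniz rule amount exactly to
the commutation `d ∘ e = e ∘ d`, which is how we encode them.
-/

open Submodule LinearMap

noncomputable section

namespace IG

variable {A : Type*} [AddCommGroup A] [Module ℝ A]

/-- `Ω^n = {α ∈ P^n : dα ∈ P^(n+1)}`. -/
def Om (d : A →ₗ[ℝ] A) (P : ℤ → Submodule ℝ A) (n : ℤ) : Submodule ℝ A :=
  P n ⊓ (P (n + 1)).comap d

/-- First component of `D` in degree `n` : `(α, β) ↦ dα + (-1)^(n-1) β∧ε`. -/
def D1 (d e : A →ₗ[ℝ] A) (n : ℤ) : A × A →ₗ[ℝ] A :=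
  d ∘ₗ LinearMap.fst ℝ A A + ((-1 : ℝ) ^ (n - 1)) • (e ∘ₗ LinearMap.snd ℝ A A)

/-- `D(α,β) = (dα + (-1)^(n-1) β∧ε, dβ)` in degree `n`. -/
def Dmap (d e : A →ₗ[ℝ] A) (n : ℤ) : A × A →ₗ[ℝ] A × A :=
  (D1 d e n).prod (d ∘ₗ LinearMap.snd ℝ A A)

/-- `K^n = {(α,β) ∈ P^n × Q^(n-1) : dβ ∈ Q^n, dα + (-1)^(n-1) β∧ε ∈ P^(n+1)}`. -/
def Ksub (d e : A →ₗ[ℝ] A) (P Q : ℤ → Submodule ℝ A) (n : ℤ) : Submodule ℝ (A × A) :=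
  (P n).comap (LinearMap.fst ℝ A A) ⊓ (Q (n - 1)).comap (LinearMap.snd ℝ A A) ⊓
    (Q n).comap (d ∘ₗ LinearMap.snd ℝ A A) ⊓ (P (n + 1)).comap (D1 d e n)

/-- `G^n = {β ∈ Q^n : dβ ∈ Q^(n+1), ∃ α ∈ P^(n+1), dα + (-1)^n β∧ε ∈ P^(n+2)}`. -/
def Gsub (d e : A →ₗ[ℝ] A) (P Q : ℤ → Submodule ℝ A) (n : ℤ) : Submodule ℝ A :=
  Q n ⊓ (Q (n + 1)).comap d ⊓
    (((P (n + 1)).comap (LinearMap.fst ℝ A A) ⊓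
        (P (n + 2)).comap
          (d ∘ₗ LinearMap.fst ℝ A A + ((-1 : ℝ) ^ n) • (e ∘ₗ LinearMap.snd ℝ A A))).map
      (LinearMap.snd ℝ A A))

/-- `C^m = ⊕_{i+2j=m} K^i ⊗ ℝ·u^j`, realized as the functions `ω : ℕ → A × A`
(`ω j` = the coefficient of `u^j`) with `ω j ∈ K^(m-2j)` for all `j`. -/
def Csub (d e : A →ₗ[ℝ] A) (P Q : ℤ → Submodule ℝ A) (m : ℤ) : Submodule ℝ (ℕ → A × A) :=
  ⨅ j : ℕ, (Ksub d e P Q (m - 2 * (j : ℤ))).comap (LinearMap.proj (R := ℝ) j)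

/-- `∇((α,β) ⊗ u^j) = D(α,β) ⊗ u^j + (-1)^(n-1) (β,0) ⊗ u^(j+1)` on total degree `m`. -/
def nabla (d e : A →ₗ[ℝ] A) (m : ℤ) : (ℕ → A × A) →ₗ[ℝ] (ℕ → A × A) :=
  LinearMap.pi fun j : ℕ =>
    Dmap d e (m - 2 * (j : ℤ)) ∘ₗ LinearMap.proj j +
      if j = 0 then 0
      else ((-1 : ℝ) ^ (m - 2 * ((j : ℤ) - 1) - 1)) •
        (LinearMap.inl ℝ A A ∘ₗ LinearMap.snd ℝ A A ∘ₗ LinearMap.proj (j - 1))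

/-- Multiplication by `u` (degree 2) on an `ℝ[u]`-module realized as `ℕ → M`. -/
def shiftL (M : Type*) [AddCommGroup M] [Module ℝ M] : (ℕ → M) →ₗ[ℝ] (ℕ → M) :=
  LinearMap.pi fun j : ℕ => if j = 0 then 0 else LinearMap.proj (j - 1)

/-- `π' (α ⊗ u^j) = (α, 0) ⊗ u^j`. -/
def piMap : (ℕ → A) →ₗ[ℝ] ℕ → A × A :=
  LinearMap.pi fun j : ℕ => LinearMap.inl ℝ A A ∘ₗ LinearMap.proj j

/-- `∮' ((α,β) ⊗ u^j) = β ⊗ u^j`. -/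
def ointMap : (ℕ → A × A) →ₗ[ℝ] ℕ → A :=
  LinearMap.pi fun j : ℕ => LinearMap.snd ℝ A A ∘ₗ LinearMap.proj j

/-- `d ⊗ 1`. -/
def dpi (d : A →ₗ[ℝ] A) : (ℕ → A) →ₗ[ℝ] ℕ → A :=
  LinearMap.pi fun j : ℕ => d ∘ₗ LinearMap.proj j

/-- `(Ω ⊗ ℝ[u])^m`. -/
def OmC (d : A →ₗ[ℝ] A) (P : ℤ → Submodule ℝ A) (m : ℤ) : Submodule ℝ (ℕ → A) :=
  ⨅ j : ℕ, (Om d P (m - 2 * (j : ℤ))).comap (LinearMap.proj (R := ℝ) j)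

/-- `(G[-1] ⊗ ℝ[u])^m` (`G[-1]` places `G^n` in degree `n+1`). -/
def GCs (d e : A →ₗ[ℝ] A) (P Q : ℤ → Submodule ℝ A) (m : ℤ) : Submodule ℝ (ℕ → A) :=
  ⨅ j : ℕ, (Gsub d e P Q (m - 1 - 2 * (j : ℤ))).comap (LinearMap.proj (R := ℝ) j)

/-- Cohomology presented as (cocycles) / (coboundaries). -/
abbrev Hq {M : Type*} [AddCommGroup M] [Module ℝ M] (Z B : Submodule ℝ M) :=
  Z ⧸ (B.comap Z.subtype)

/-- Cocycles of `Ω`. -/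
def ZOm (d : A →ₗ[ℝ] A) (P : ℤ → Submodule ℝ A) (n : ℤ) : Submodule ℝ A :=
  Om d P n ⊓ LinearMap.ker d

/-- Coboundaries of `Ω`. -/
def BOm (d : A →ₗ[ℝ] A) (P : ℤ → Submodule ℝ A) (n : ℤ) : Submodule ℝ A :=
  (Om d P (n - 1)).map d

/-- `H^n(Ω)`. -/
abbrev HOm (d : A →ₗ[ℝ] A) (P : ℤ → Submodule ℝ A) (n : ℤ) :=
  Hq (ZOm d P n) (BOm d P n)

/-- Cocycles of `G`. -/
def ZG (d e : A →ₗ[ℝ] A) (P Q : ℤ → Submodule ℝ A) (n : ℤ) : Submodule ℝ A :=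
  Gsub d e P Q n ⊓ LinearMap.ker d

/-- Coboundaries of `G`. -/
def BG (d e : A →ₗ[ℝ] A) (P Q : ℤ → Submodule ℝ A) (n : ℤ) : Submodule ℝ A :=
  (Gsub d e P Q (n - 1)).map d

/-- `H^n(G)`. -/
abbrev HG (d e : A →ₗ[ℝ] A) (P Q : ℤ → Submodule ℝ A) (n : ℤ) :=
  Hq (ZG d e P Q n) (BG d e P Q n)

/-- The co-Gysin space `𝒦^n = Ω^n / G^n` (cochain level). -/
abbrev Kq (d e : A →ₗ[ℝ] A) (P Q : ℤ → Submodule ℝ A) (n : ℤ) :=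
  (Om d P n) ⧸ ((Gsub d e P Q n).comap (Om d P n).subtype)

/-- Cocycles of the co-Gysin complex `𝒦 = Ω/G`, presented by representatives:
`α ∈ Ω^n` with `dα ∈ G^(n+1)`. -/
def ZKo (d e : A →ₗ[ℝ] A) (P Q : ℤ → Submodule ℝ A) (n : ℤ) : Submodule ℝ A :=
  Om d P n ⊓ (Gsub d e P Q (n + 1)).comap d

/-- Representatives of coboundaries of `𝒦 = Ω/G`. -/
def BKo (d e : A →ₗ[ℝ] A) (P Q : ℤ → Submodule ℝ A) (n : ℤ) : Submodule ℝ A :=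
  Gsub d e P Q n ⊔ (Om d P (n - 1)).map d

/-- `H^n(𝒦)`. -/
abbrev HKo (d e : A →ₗ[ℝ] A) (P Q : ℤ → Submodule ℝ A) (n : ℤ) :=
  Hq (ZKo d e P Q n) (BKo d e P Q n)

/-- Cocycles of `(C, ∇)`. -/
def ZC (d e : A →ₗ[ℝ] A) (P Q : ℤ → Submodule ℝ A) (m : ℤ) : Submodule ℝ (ℕ → A × A) :=
  Csub d e P Q m ⊓ LinearMap.ker (nabla d e m)

/-- Coboundaries of `(C, ∇)`. -/
def BC (d e : A →ₗ[ℝ] A) (P Q : ℤ → Submodule ℝ A) (m : ℤ) : Submodule ℝ (ℕ → A × A) :=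
  (Csub d e P Q (m - 1)).map (nabla d e (m - 1))

/-- `H^m(C)`, the equivariant intersection cohomology. -/
abbrev HC (d e : A →ₗ[ℝ] A) (P Q : ℤ → Submodule ℝ A) (m : ℤ) :=
  Hq (ZC d e P Q m) (BC d e P Q m)

/-- Cocycles of `(Ω ⊗ ℝ[u], d ⊗ 1)`. -/
def ZOmC (d : A →ₗ[ℝ] A) (P : ℤ → Submodule ℝ A) (m : ℤ) : Submodule ℝ (ℕ → A) :=
  OmC d P m ⊓ LinearMap.ker (dpi d)

/-- Coboundaries of `(Ω ⊗ ℝ[u], d ⊗ 1)`. -/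
def BOmC (d : A →ₗ[ℝ] A) (P : ℤ → Submodule ℝ A) (m : ℤ) : Submodule ℝ (ℕ → A) :=
  (OmC d P (m - 1)).map (dpi d)

/-- `[H(Ω) ⊗ ℝ[u]]^m`, as the cohomology of the complex `(Ω ⊗ ℝ[u], d ⊗ 1)`. -/
abbrev HOmCq (d : A →ₗ[ℝ] A) (P : ℤ → Submodule ℝ A) (m : ℤ) :=
  Hq (ZOmC d P m) (BOmC d P m)

/-- Cocycles of `(G[-1] ⊗ ℝ[u], d ⊗ 1)`. -/
def ZGC (d e : A →ₗ[ℝ] A) (P Q : ℤ → Submodule ℝ A) (m : ℤ) : Submodule ℝ (ℕ → A) :=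
  GCs d e P Q m ⊓ LinearMap.ker (dpi d)

/-- Coboundaries of `(G[-1] ⊗ ℝ[u], d ⊗ 1)`. -/
def BGC (d e : A →ₗ[ℝ] A) (P Q : ℤ → Submodule ℝ A) (m : ℤ) : Submodule ℝ (ℕ → A) :=
  (GCs d e P Q (m - 1)).map (dpi d)

/-- `[H(G) ⊗ ℝ[u]]^(m-1)`, as the cohomology of `(G[-1] ⊗ ℝ[u], d ⊗ 1)` in degree `m`. -/
abbrev HGCq (d e : A →ₗ[ℝ] A) (P Q : ℤ → Submodule ℝ A) (m : ℤ) :=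
  Hq (ZGC d e P Q m) (BGC d e P Q m)

/-- The subspace of `ω : ℕ → A × A` supported in (filtration) degrees `≥ i`
(for total degree `m`): `ω j = 0` whenever `m - 2j < i`. -/
def Supp (i m : ℤ) : Submodule ℝ (ℕ → A × A) :=
  ⨅ (j : ℕ) (_ : m - 2 * (j : ℤ) < i),
    LinearMap.ker (LinearMap.proj (R := ℝ) (φ := fun _ : ℕ => A × A) j)

/-- The filtration `F^i C^m = {ω ∈ ⊕_{i'≥i} K^{i'} ⊗ ℝ[u] of total degree m :
∇ω ∈ ⊕_{i'≥i} K^{i'} ⊗ ℝ[u]}`. -/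
def FC (d e : A →ₗ[ℝ] A) (P Q : ℤ → Submodule ℝ A) (i m : ℤ) : Submodule ℝ (ℕ → A × A) :=
  Csub d e P Q m ⊓ Supp i m ⊓ (Supp i (m + 1)).comap (nabla d e m)

/-- `Z_r^{i,j} = F^i C^(i+j) ∩ ∇⁻¹(F^(i+r) C^(i+j+1))`. -/
def Zsp (d e : A →ₗ[ℝ] A) (P Q : ℤ → Submodule ℝ A) (r i j : ℤ) : Submodule ℝ (ℕ → A × A) :=
  FC d e P Q i (i + j) ⊓ (FC d e P Q (i + r) (i + j + 1)).comap (nabla d e (i + j))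

/-- `B_r^{i,j} = F^i C^(i+j) ∩ ∇(F^(i-r) C^(i+j-1))`. -/
def Bsp (d e : A →ₗ[ℝ] A) (P Q : ℤ → Submodule ℝ A) (r i j : ℤ) : Submodule ℝ (ℕ → A × A) :=
  FC d e P Q i (i + j) ⊓ (FC d e P Q (i - r) (i + j - 1)).map (nabla d e (i + j - 1))

/-- `E_r^{i,j} = Z_r^{i,j} / (Z_(r-1)^{i+1,j-1} + B_(r-1)^{i,j})`. -/
abbrev Esp (d e : A →ₗ[ℝ] A) (P Q : ℤ → Submodule ℝ A) (r i j : ℤ) :=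
  Zsp d e P Q r i j ⧸
    ((Zsp d e P Q (r - 1) (i + 1) (j - 1) ⊔ Bsp d e P Q (r - 1) i j).comap
      (Zsp d e P Q r i j).subtype)

/-- The differential `d_r : E_r^{i,j} → E_r^{i+r,j-r+1}` is the map induced by `∇`
(the target indices `(i', j')` are given freely, to be instantiated by
expressions equal to `(i + r, j - r + 1)`). -/
def DrChar (d e : A →ₗ[ℝ] A) (P Q : ℤ → Submodule ℝ A) (r i j i' j' : ℤ)
    (dr : Esp d e P Q r i j →ₗ[ℝ] Esp d e P Q r i' j') : Prop :=
  ∀ (ω : ℕ → A × A) (hω : ω ∈ Zsp d e P Q r i j)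
    (hω' : nabla d e (i + j) ω ∈ Zsp d e P Q r i' j'),
    dr (Submodule.Quotient.mk ⟨ω, hω⟩) = Submodule.Quotient.mk ⟨nabla d e (i + j) ω, hω'⟩

/-- `α ↦ (α, 0) ⊗ u^0 = (α,0) ⊗ 1`. -/
def embL : A →ₗ[ℝ] ℕ → A × A :=
  LinearMap.single ℝ (fun _ : ℕ => A × A) 0 ∘ₗ LinearMap.inl ℝ A A

/-- `ι̃ : H^n(G) → H^{n'}(Ω)` induced by the inclusion `G ⊆ Ω` (`n' = n`). -/
def iotaChar (d e : A →ₗ[ℝ] A) (P Q : ℤ → Submodule ℝ A) (n n' : ℤ)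
    (ι : HG d e P Q n →ₗ[ℝ] HOm d P n') : Prop :=
  ∀ (β : A) (hβ : β ∈ ZG d e P Q n) (hβ' : β ∈ ZOm d P n'),
    ι (Submodule.Quotient.mk ⟨β, hβ⟩) = Submodule.Quotient.mk ⟨β, hβ'⟩

/-- `𝕖 : H^n(G) → H^{n'}(Ω)`, `𝕖[β] = [dα + (-1)^n β∧ε]` for any witness `α`
(`n' = n + 2`). -/
def eulerChar (d e : A →ₗ[ℝ] A) (P Q : ℤ → Submodule ℝ A) (n n' : ℤ)
    (E : HG d e P Q n →ₗ[ℝ] HOm d P n') : Prop :=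
  ∀ (β : A) (hβ : β ∈ ZG d e P Q n) (α : A) (_ : α ∈ P (n + 1))
    (hz : d α + ((-1 : ℝ) ^ n) • e β ∈ ZOm d P n'),
    E (Submodule.Quotient.mk ⟨β, hβ⟩) =
      Submodule.Quotient.mk ⟨d α + ((-1 : ℝ) ^ n) • e β, hz⟩

/-- `∂ : H^n(𝒦) → H^{n'}(G)`, `∂[ᾱ] = [dα]` (`n' = n + 1`). -/
def partialChar (d e : A →ₗ[ℝ] A) (P Q : ℤ → Submodule ℝ A) (n n' : ℤ)
    (pd : HKo d e P Q n →ₗ[ℝ] HG d e P Q n') : Prop :=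
  ∀ (α : A) (hα : α ∈ ZKo d e P Q n) (hd : d α ∈ ZG d e P Q n'),
    pd (Submodule.Quotient.mk ⟨α, hα⟩) = Submodule.Quotient.mk ⟨d α, hd⟩

/-- `Pr : H^n(Ω) → H^{n'}(𝒦)` induced by the projection `Ω → 𝒦 = Ω/G` (`n' = n`). -/
def prChar (d e : A →ₗ[ℝ] A) (P Q : ℤ → Submodule ℝ A) (n n' : ℤ)
    (pr : HOm d P n →ₗ[ℝ] HKo d e P Q n') : Prop :=
  ∀ (α : A) (hα : α ∈ ZOm d P n) (hα' : α ∈ ZKo d e P Q n'),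
    pr (Submodule.Quotient.mk ⟨α, hα⟩) = Submodule.Quotient.mk ⟨α, hα'⟩

section CochainLemmas

variable {d e : A →ₗ[ℝ] A} {P Q : ℤ → Submodule ℝ A} {m : ℤ}

theorem neg_one_zpow_sub_two_mul_sub_one (n k : ℤ) :
    (-1 : ℝ) ^ (n - 2 * k - 1) = (-1 : ℝ) ^ (n - 1) := by
  rw [sub_right_comm, zpow_sub₀ (by norm_num), zpow_mul]
  norm_num

theorem neg_one_zpow_add_one (n : ℤ) : (-1 : ℝ) ^ (n + 1) = -(-1 : ℝ) ^ n := by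
  rw [zpow_add₀ (by norm_num)]
  norm_num

theorem mem_of_degree_eq {M : Type*} [AddCommGroup M] [Module ℝ M] {R : ℤ → Submodule ℝ M}
    {x : M} {n n' : ℤ} (hx : x ∈ R n) (h : n = n') : x ∈ R n' := h ▸ hx

theorem mem_Om {n : ℤ} {α : A} : α ∈ Om d P n ↔ α ∈ P n ∧ d α ∈ P (n + 1) := by
  simp [Om]

theorem mem_Ksub {n : ℤ} {x : A × A} :
    x ∈ Ksub d e P Q n ↔ x.1 ∈ P n ∧ x.2 ∈ Q (n - 1) ∧ d x.2 ∈ Q n ∧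
      d x.1 + ((-1 : ℝ) ^ (n - 1)) • e x.2 ∈ P (n + 1) := by
  simp [Ksub, D1, and_assoc]

theorem mem_Gsub {n : ℤ} {β : A} :
    β ∈ Gsub d e P Q n ↔ β ∈ Q n ∧ d β ∈ Q (n + 1) ∧
      ∃ α ∈ P (n + 1), d α + ((-1 : ℝ) ^ n) • e β ∈ P (n + 2) := by
  simp [Gsub, and_assoc]

theorem mem_Csub {ω : ℕ → A × A} :
    ω ∈ Csub d e P Q m ↔ ∀ j : ℕ, ω j ∈ Ksub d e P Q (m - 2 * (j : ℤ)) := by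
  simp [Csub]

theorem mem_OmC {ω : ℕ → A} :
    ω ∈ OmC d P m ↔ ∀ j : ℕ, ω j ∈ Om d P (m - 2 * (j : ℤ)) := by
  simp [OmC]

theorem mem_GCs {ω : ℕ → A} :
    ω ∈ GCs d e P Q m ↔ ∀ j : ℕ, ω j ∈ Gsub d e P Q (m - 1 - 2 * (j : ℤ)) := by
  simp [GCs]

theorem nabla_apply (ω : ℕ → A × A) (j : ℕ) :
    nabla d e m ω j =
      (d (ω j).1 + ((-1 : ℝ) ^ (m - 1)) • e (ω j).2 +
        ((-1 : ℝ) ^ (m - 1)) • (if j = 0 then 0 else (ω (j - 1)).2), d (ω j).2) := by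
  rcases eq_or_ne j 0 with rfl | hj
  · simp [nabla, Dmap, D1]
  · simp [nabla, Dmap, D1, hj, neg_one_zpow_sub_two_mul_sub_one]

theorem nabla_nabla (hd : d ∘ₗ d = 0) (hde : d ∘ₗ e = e ∘ₗ d) {m' : ℤ} (hm : m' = m + 1)
    (ω : ℕ → A × A) : nabla d e m' (nabla d e m ω) = 0 := by
  have hd' (x : A) : d (d x) = 0 := LinearMap.congr_fun hd x
  have hde' (x : A) : d (e x) = e (d x) := LinearMap.congr_fun hde x
  have hs : (-1 : ℝ) ^ (m' - 1) = -(-1 : ℝ) ^ (m - 1) := by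
    rw [← neg_one_zpow_add_one, hm]; congr 1; ring
  funext j
  rcases eq_or_ne j 0 with rfl | hj
  · simp [nabla_apply, hd', hde', hs]
  · simp [nabla_apply, hd', hde', hs, hj]

theorem nabla_mem_Csub (hd : d ∘ₗ d = 0) (hde : d ∘ₗ e = e ∘ₗ d) (hQP : ∀ n, Q n ≤ P n)
    {m' : ℤ} (hm : m' = m + 1) {ω : ℕ → A × A} (hω : ω ∈ Csub d e P Q m) :
    nabla d e m ω ∈ Csub d e P Q m' := by
  have hd' (x : A) : d (d x) = 0 := LinearMap.congr_fun hd x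
  have hde' (x : A) : d (e x) = e (d x) := LinearMap.congr_fun hde x
  have hsgn' (k : ℤ) : (-1 : ℝ) ^ (m' - 2 * k - 1) = -(-1 : ℝ) ^ (m - 1) := by
    rw [← neg_one_zpow_sub_two_mul_sub_one m k, ← neg_one_zpow_add_one, hm]; congr 1; ring
  rw [mem_Csub] at hω ⊢
  intro j
  obtain ⟨-, h2, h3, h4⟩ := mem_Ksub.1 (hω j)
  rw [neg_one_zpow_sub_two_mul_sub_one] at h4
  -- the contribution of the coefficient of `u ^ (j - 1)`
  have key : (if j = 0 then 0 else (ω (j - 1)).2) ∈ P (m' - 2 * (j : ℤ)) ∧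
      d (if j = 0 then 0 else (ω (j - 1)).2) ∈ P (m' - 2 * (j : ℤ) + 1) := by
    rcases j with _ | k
    · simp
    · obtain ⟨-, h2', h3', -⟩ := mem_Ksub.1 (hω k)
      simp only [Nat.add_eq_zero_iff, one_ne_zero, and_false, if_false, Nat.add_sub_cancel]
      exact ⟨mem_of_degree_eq (hQP _ h2') (by push_cast; omega),
        mem_of_degree_eq (hQP _ h3') (by push_cast; omega)⟩
  rw [nabla_apply, mem_Ksub]
  refine ⟨add_mem (mem_of_degree_eq h4 (by omega)) (smul_mem _ _ key.1),
    mem_of_degree_eq h3 (by omega), by simp [hd'], ?_⟩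
  convert smul_mem _ ((-1 : ℝ) ^ (m - 1)) key.2 using 1
  simp only [map_add, map_smul, hd', hde', hsgn']
  module

theorem nabla_piMap (a : ℕ → A) : nabla d e m (piMap a) = piMap (dpi d a) := by
  funext j
  rw [nabla_apply]
  simp [piMap, dpi]

theorem ointMap_nabla (ω : ℕ → A × A) :
    ointMap (nabla d e m ω) = dpi d (ointMap ω) := by
  funext j
  simp [ointMap, dpi, nabla_apply]

theorem ointMap_piMap (a : ℕ → A) : ointMap (piMap a) = 0 := by
  funext j
  simp [ointMap, piMap]

theorem piMap_injective : Function.Injective (piMap : (ℕ → A) →ₗ[ℝ] ℕ → A × A) := by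
  intro a b h
  funext j
  simpa [piMap] using congr_fun h j

theorem piMap_mem_Csub_iff {a : ℕ → A} : piMap a ∈ Csub d e P Q m ↔ a ∈ OmC d P m := by
  simp [mem_Csub, mem_OmC, mem_Ksub, mem_Om, piMap]

theorem exists_piMap_eq {ω : ℕ → A × A} (hω : ω ∈ Csub d e P Q m) (h0 : ointMap ω = 0) :
    ∃ a ∈ OmC d P m, piMap a = ω := by
  have h : piMap (fun j => (ω j).1) = ω := by
    funext j
    have := congr_fun h0 j
    simp only [ointMap, LinearMap.pi_apply, LinearMap.comp_apply, LinearMap.proj_apply,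
      LinearMap.snd_apply, Pi.zero_apply] at this
    simp [piMap, Prod.ext_iff, this]
  exact ⟨_, piMap_mem_Csub_iff.1 (h ▸ hω), h⟩

theorem mem_ZOmC {a : ℕ → A} : a ∈ ZOmC d P m ↔ a ∈ OmC d P m ∧ dpi d a = 0 := Iff.rfl

theorem mem_ZC {ω : ℕ → A × A} :
    ω ∈ ZC d e P Q m ↔ ω ∈ Csub d e P Q m ∧ nabla d e m ω = 0 := Iff.rfl

theorem mem_ZGC {g : ℕ → A} : g ∈ ZGC d e P Q m ↔ g ∈ GCs d e P Q m ∧ dpi d g = 0 := Iff.rfl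

theorem piMap_mem_ZC_iff {a : ℕ → A} : piMap a ∈ ZC d e P Q m ↔ a ∈ ZOmC d P m := by
  rw [mem_ZC, mem_ZOmC, piMap_mem_Csub_iff, nabla_piMap, map_eq_zero_iff _ piMap_injective]

theorem mem_Gsub_of_mem_Ksub {n n' : ℤ} (hn : n' = n - 1) {x : A × A}
    (hx : x ∈ Ksub d e P Q n) : x.2 ∈ Gsub d e P Q n' := by
  subst hn
  obtain ⟨h1, h2, h3, h4⟩ := mem_Ksub.1 hx
  exact mem_Gsub.2 ⟨h2, mem_of_degree_eq h3 (by ring), x.1, mem_of_degree_eq h1 (by ring),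
    mem_of_degree_eq h4 (by ring)⟩

theorem exists_mem_Ksub {n n' : ℤ} (hn : n' = n - 1) {β : A} (hβ : β ∈ Gsub d e P Q n') :
    ∃ α, (α, β) ∈ Ksub d e P Q n := by
  subst hn
  obtain ⟨h1, h2, α, h3, h4⟩ := mem_Gsub.1 hβ
  exact ⟨α, mem_Ksub.2 ⟨mem_of_degree_eq h3 (by ring), h1, mem_of_degree_eq h2 (by ring),
    mem_of_degree_eq h4 (by ring)⟩⟩

theorem ointMap_mem_GCs {ω : ℕ → A × A} (hω : ω ∈ Csub d e P Q m) :
    ointMap ω ∈ GCs d e P Q m :=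
  mem_GCs.2 fun j => mem_Gsub_of_mem_Ksub (by ring) (mem_Csub.1 hω j)

theorem exists_ointMap_eq {g : ℕ → A} (hg : g ∈ GCs d e P Q m) :
    ∃ ω ∈ Csub d e P Q m, ointMap ω = g := by
  choose α hα using fun j : ℕ => exists_mem_Ksub (n := m - 2 * (j : ℤ)) (by ring) (mem_GCs.1 hg j)
  exact ⟨fun j => (α j, g j), mem_Csub.2 hα, by funext j; simp [ointMap]⟩

theorem single_mem_Csub {j : ℕ} {x : A × A} (hx : x ∈ Ksub d e P Q (m - 2 * (j : ℤ))) :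
    Pi.single j x ∈ Csub d e P Q m := by
  rw [mem_Csub]
  intro k
  rcases eq_or_ne k j with rfl | hk
  · simpa using hx
  · simp [hk]

theorem ointMap_single (j : ℕ) (x : A × A) :
    ointMap (Pi.single j x) = Pi.single j x.2 := by
  funext k
  rcases eq_or_ne k j with rfl | hk
  · simp [ointMap]
  · simp [ointMap, hk]

theorem nabla_single (j : ℕ) (α β : A) (hβ : d β = 0) :
    nabla d e m (Pi.single j (α, β)) =
      piMap (Pi.single j (d α + ((-1 : ℝ) ^ (m - 1)) • e β)
        + Pi.single (j + 1) (((-1 : ℝ) ^ (m - 1)) • β)) := by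
  funext k
  rw [nabla_apply]
  rcases eq_or_ne k j with rfl | hk
  · rcases k with _ | k <;> simp [piMap, hβ]
  · rcases k with _ | k
    · simp [piMap, hk]
    · rcases eq_or_ne k j with rfl | hk'
      · simp [piMap]
      · simp [piMap, hk, hk']

theorem mem_ZOmC_of_piMap_eq_nabla (hd : d ∘ₗ d = 0) (hde : d ∘ₗ e = e ∘ₗ d)
    (hQP : ∀ n, Q n ≤ P n) {ω : ℕ → A × A} (hω : ω ∈ Csub d e P Q m) {η : ℕ → A}
    (h : nabla d e m ω = piMap η) : η ∈ ZOmC d P (m + 1) := by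
  rw [← piMap_mem_ZC_iff (e := e) (Q := Q), ← h]
  exact ⟨nabla_mem_Csub hd hde hQP rfl hω, nabla_nabla hd hde rfl ω⟩

theorem Hq_mk_eq_zero {M : Type*} [AddCommGroup M] [Module ℝ M] {Z B : Submodule ℝ M} {x : M}
    (hx : x ∈ Z) : (Submodule.Quotient.mk ⟨x, hx⟩ : Hq Z B) = 0 ↔ x ∈ B := by
  rw [Submodule.Quotient.mk_eq_zero]
  rfl

theorem Hq_mk_eq_mk {M : Type*} [AddCommGroup M] [Module ℝ M] {Z B : Submodule ℝ M} {x y : M}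
    (hx : x ∈ Z) (hy : y ∈ Z) :
    (Submodule.Quotient.mk ⟨x, hx⟩ : Hq Z B) = Submodule.Quotient.mk ⟨y, hy⟩ ↔ x - y ∈ B := by
  rw [Submodule.Quotient.eq]
  rfl

theorem mem_BC_succ {ω : ℕ → A × A} :
    ω ∈ BC d e P Q (m + 1) ↔ ∃ ψ ∈ Csub d e P Q m, nabla d e m ψ = ω := by
  rw [BC, add_sub_cancel_right]
  rfl

theorem mem_BOmC_succ {a : ℕ → A} :
    a ∈ BOmC d P (m + 1) ↔ ∃ θ ∈ OmC d P m, dpi d θ = a := by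
  rw [BOmC, add_sub_cancel_right]
  rfl

/-- The connecting homomorphism, prescribed on the classes `[β] ⊗ u^j`, is computed on every
class by lifting a representative along `∮'` and applying `∇`. -/
theorem exists_lift_connecting (hd : d ∘ₗ d = 0) (hde : d ∘ₗ e = e ∘ₗ d)
    (hQP : ∀ n, Q n ≤ P n) (hQneg : ∀ n : ℤ, n < 0 → Q n = ⊥)
    (δH : HGCq d e P Q m →ₗ[ℝ] HOmCq d P (m + 1))
    (hδH : ∀ (j : ℕ) (β : A) (_ : β ∈ ZG d e P Q (m - 1 - 2 * (j : ℤ)))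
      (hg : Pi.single j β ∈ ZGC d e P Q m)
      (α : A) (_ : α ∈ P (m - 2 * (j : ℤ)))
      (_ : d α + ((-1 : ℝ) ^ (m - 1)) • e β ∈ P (m + 1 - 2 * (j : ℤ)))
      (hz : Pi.single j (d α + ((-1 : ℝ) ^ (m - 1)) • e β)
          + Pi.single (j + 1) (((-1 : ℝ) ^ (m - 1)) • β) ∈ ZOmC d P (m + 1)),
      δH (Submodule.Quotient.mk ⟨Pi.single j β, hg⟩) =
        Submodule.Quotient.mk ⟨_, hz⟩)
    (g : ℕ → A) (hg : g ∈ ZGC d e P Q m) :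
    ∃ ω ∈ Csub d e P Q m, ointMap ω = g ∧ ∃ (η : ℕ → A) (hη : η ∈ ZOmC d P (m + 1)),
      nabla d e m ω = piMap η ∧
        δH (Submodule.Quotient.mk ⟨g, hg⟩) = Submodule.Quotient.mk ⟨η, hη⟩ := by
  have hgG := mem_GCs.1 hg.1
  have hgd (j : ℕ) : d (g j) = 0 := by simpa [dpi] using congr_fun (mem_ZGC.1 hg).2 j
  have hsum : ∀ s : Finset ℕ, ∃ (hs : ∑ j ∈ s, Pi.single j (g j) ∈ ZGC d e P Q m),
      ∃ ω ∈ Csub d e P Q m, ointMap ω = ∑ j ∈ s, Pi.single j (g j) ∧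
        ∃ (η : ℕ → A) (hη : η ∈ ZOmC d P (m + 1)), nabla d e m ω = piMap η ∧
          δH (Submodule.Quotient.mk ⟨_, hs⟩) = Submodule.Quotient.mk ⟨η, hη⟩ := by
    intro s
    induction s using Finset.induction_on with
    | empty =>
      refine ⟨zero_mem _, 0, zero_mem _, by simp, 0, zero_mem _, by simp, ?_⟩
      exact map_zero δH
    | insert j s hj ih =>
      obtain ⟨hs, ω, hω, hωg, η, hη, hωη, hδ⟩ := ih
      obtain ⟨α, hα⟩ := exists_mem_Ksub (n := m - 2 * (j : ℤ)) (by ring) (hgG j)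
      have hω' := single_mem_Csub hα
      have hη' := nabla_single (m := m) (e := e) j α (g j) (hgd j)
      have hη'Z := mem_ZOmC_of_piMap_eq_nabla hd hde hQP hω' hη'
      have hgj : Pi.single j (g j) ∈ ZGC d e P Q m := by
        have h := ointMap_mem_GCs hω'
        rw [ointMap_single] at h
        refine mem_ZGC.2 ⟨h, ?_⟩
        funext k
        rcases eq_or_ne k j with rfl | hk
        · simp [dpi, hgd]
        · simp [dpi, hk]
      obtain ⟨hα1, -, -, hα2⟩ := mem_Ksub.1 hα
      rw [neg_one_zpow_sub_two_mul_sub_one] at hα2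
      have hδ' := hδH j (g j) ⟨hgG j, hgd j⟩ hgj α hα1 (mem_of_degree_eq hα2 (by ring)) hη'Z
      simp only [Finset.sum_insert hj]
      refine ⟨add_mem hgj hs, _, add_mem hω' hω, by rw [map_add, ointMap_single, hωg], _,
        add_mem hη'Z hη, by rw [map_add, hη', hωη, ← map_add], ?_⟩
      exact (map_add δH (Submodule.Quotient.mk ⟨_, hgj⟩) (Submodule.Quotient.mk ⟨_, hs⟩)).trans
        (congr_arg₂ (· + ·) hδ' hδ)
  have hg_sum : ∑ j ∈ Finset.range m.toNat, Pi.single j (g j) = g := by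
    funext k
    rw [Finset.sum_apply, Finset.sum_pi_single]
    split_ifs with hk
    · rfl
    · have hQ := (mem_Gsub.1 (hgG k)).1
      rw [hQneg _ (by rw [Finset.mem_range] at hk; omega), Submodule.mem_bot] at hQ
      exact hQ.symm
  have h := hsum (Finset.range m.toNat)
  simp only [hg_sum] at h
  exact h.2

end CochainLemmas

/-- the short exact sequence `0 → Ω⊗ℝ[u] → C → G[-1]⊗ℝ[u] → 0` induces a
long exact sequence
`⋯ → [H(Ω)⊗ℝ[u]]^i → H^i(C) → [H(G)⊗ℝ[u]]^(i-1) → [H(Ω)⊗ℝ[u]]^(i+1) → ⋯`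
in which the connecting homomorphism is `δ = 𝕖⊗1 ± ι̃⊗u`:  for a cocycle
`β ∈ G^(i-1-2j)` and any `α ∈ P^(i-2j)` with `dα + (-1)^(i-1) β∧ε ∈ P^(i+1-2j)`,
`δ([β]⊗u^j) = [dα + (-1)^(i-1) β∧ε]⊗u^j + (-1)^(i-1) ι̃[β]⊗u^(j+1)`.
Here `[H(Ω)⊗ℝ[u]]^m` (resp. `[H(G)⊗ℝ[u]]^(m-1)`) is realized as the degree-`m`
cohomology of the complex `(Ω⊗ℝ[u], d⊗1)` (resp. `(G[-1]⊗ℝ[u], d⊗1)`), and the maps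
`π'`, `∮'`, `δ` are taken to be any linear maps with the prescribed action on classes. -/
theorem statement_4 {A : Type*} [AddCommGroup A] [Module ℝ A]
    (d e : A →ₗ[ℝ] A) (hd : d ∘ₗ d = 0) (hde : d ∘ₗ e = e ∘ₗ d)
    (P Q : ℤ → Submodule ℝ A) (hQP : ∀ n, Q n ≤ P n)
    (hPneg : ∀ n : ℤ, n < 0 → P n = ⊥) (hQneg : ∀ n : ℤ, n < 0 → Q n = ⊥)
    (i : ℤ)
    -- π' in cohomology, in degrees i and i+1
    (piH : HOmCq d P i →ₗ[ℝ] HC d e P Q i)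
    (hpiH : ∀ (ω : ℕ → A) (hω : ω ∈ ZOmC d P i) (h2 : piMap ω ∈ ZC d e P Q i),
      piH (Submodule.Quotient.mk ⟨ω, hω⟩) = Submodule.Quotient.mk ⟨piMap ω, h2⟩)
    (piH' : HOmCq d P (i + 1) →ₗ[ℝ] HC d e P Q (i + 1))
    (hpiH' : ∀ (ω : ℕ → A) (hω : ω ∈ ZOmC d P (i + 1)) (h2 : piMap ω ∈ ZC d e P Q (i + 1)),
      piH' (Submodule.Quotient.mk ⟨ω, hω⟩) = Submodule.Quotient.mk ⟨piMap ω, h2⟩)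
    -- ∮' in cohomology, in degree i
    (oH : HC d e P Q i →ₗ[ℝ] HGCq d e P Q i)
    (hoH : ∀ (ω : ℕ → A × A) (hω : ω ∈ ZC d e P Q i) (h2 : ointMap ω ∈ ZGC d e P Q i),
      oH (Submodule.Quotient.mk ⟨ω, hω⟩) = Submodule.Quotient.mk ⟨ointMap ω, h2⟩)
    -- the connecting morphism δ = 𝕖⊗1 ± ι̃⊗u
    (δH : HGCq d e P Q i →ₗ[ℝ] HOmCq d P (i + 1))
    (hδH : ∀ (j : ℕ) (β : A) (hβ : β ∈ ZG d e P Q (i - 1 - 2 * (j : ℤ)))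
      (hg : Pi.single j β ∈ ZGC d e P Q i)
      (α : A) (_ : α ∈ P (i - 2 * (j : ℤ)))
      (_ : d α + ((-1 : ℝ) ^ (i - 1)) • e β ∈ P (i + 1 - 2 * (j : ℤ)))
      (hz : Pi.single j (d α + ((-1 : ℝ) ^ (i - 1)) • e β)
          + Pi.single (j + 1) (((-1 : ℝ) ^ (i - 1)) • β) ∈ ZOmC d P (i + 1)),
      δH (Submodule.Quotient.mk ⟨Pi.single j β, hg⟩) =
        Submodule.Quotient.mk ⟨_, hz⟩) :
    -- exactness at H^i(C)
    (∀ x : HC d e P Q i, oH x = 0 ↔ ∃ y, piH y = x) ∧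
    -- exactness at [H(G)⊗ℝ[u]]^(i-1)
    (∀ g : HGCq d e P Q i, δH g = 0 ↔ ∃ x, oH x = g) ∧
    -- exactness at [H(Ω)⊗ℝ[u]]^(i+1)
    (∀ z : HOmCq d P (i + 1), piH' z = 0 ↔ ∃ g, δH g = z) := by
  have hlift := exists_lift_connecting hd hde hQP hQneg δH hδH
  refine ⟨fun x => ?_, fun x => ?_, fun x => ?_⟩
  · obtain ⟨⟨ω, hω⟩, rfl⟩ := Submodule.Quotient.mk_surjective _ x
    have hoω : ointMap ω ∈ ZGC d e P Q i :=
      mem_ZGC.2 ⟨ointMap_mem_GCs hω.1, by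
        rw [← ointMap_nabla (e := e) (m := i), (mem_ZC.1 hω).2, map_zero]⟩
    rw [hoH ω hω hoω, Hq_mk_eq_zero]
    constructor
    · rintro ⟨γ, hγ, hγω⟩
      obtain ⟨ψ, hψ, rfl⟩ := exists_ointMap_eq hγ
      have hψC : nabla d e (i - 1) ψ ∈ Csub d e P Q i :=
        nabla_mem_Csub hd hde hQP (by ring) hψ
      obtain ⟨a, -, haω⟩ := exists_piMap_eq (sub_mem hω.1 hψC)
        (by rw [map_sub, ointMap_nabla, hγω, sub_self])
      have haZ : piMap a ∈ ZC d e P Q i := by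
        rw [haω]
        exact sub_mem hω ⟨hψC, nabla_nabla hd hde (by ring) ψ⟩
      refine ⟨Submodule.Quotient.mk ⟨a, piMap_mem_ZC_iff.1 haZ⟩, ?_⟩
      rw [hpiH a _ haZ, Hq_mk_eq_mk, haω]
      exact ⟨-ψ, neg_mem hψ, by rw [map_neg]; abel⟩
    · rintro ⟨y, hy⟩
      obtain ⟨⟨a, ha⟩, rfl⟩ := Submodule.Quotient.mk_surjective _ y
      rw [hpiH a ha (piMap_mem_ZC_iff.2 ha), Hq_mk_eq_mk] at hy
      obtain ⟨ψ, hψ, hψω⟩ := hy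
      refine ⟨-ointMap ψ, neg_mem (ointMap_mem_GCs hψ), ?_⟩
      rw [map_neg, ← ointMap_nabla, hψω, map_sub, ointMap_piMap, zero_sub, neg_neg]
  · obtain ⟨⟨g, hg⟩, rfl⟩ := Submodule.Quotient.mk_surjective _ x
    constructor
    · intro h
      obtain ⟨ω, hω, hωg, η, hη, hωη, hδ⟩ := hlift g hg
      rw [hδ, Hq_mk_eq_zero, mem_BOmC_succ] at h
      obtain ⟨θ, hθ, hθη⟩ := h
      have hZ : ω - piMap θ ∈ ZC d e P Q i :=
        mem_ZC.2 ⟨sub_mem hω (piMap_mem_Csub_iff.2 hθ), by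
          rw [map_sub, nabla_piMap, hωη, hθη, sub_self]⟩
      have ho : ointMap (ω - piMap θ) = g := by rw [map_sub, ointMap_piMap, hωg, sub_zero]
      refine ⟨Submodule.Quotient.mk ⟨_, hZ⟩, ?_⟩
      rw [hoH _ hZ (ho.symm ▸ hg), Hq_mk_eq_mk, ho, sub_self]
      exact zero_mem _
    · rintro ⟨y, hy⟩
      obtain ⟨⟨ω', hω'⟩, rfl⟩ := Submodule.Quotient.mk_surjective _ y
      have ho : ointMap ω' ∈ ZGC d e P Q i :=
        mem_ZGC.2 ⟨ointMap_mem_GCs hω'.1, by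
          rw [← ointMap_nabla (e := e) (m := i), (mem_ZC.1 hω').2, map_zero]⟩
      rw [hoH ω' hω' ho] at hy
      obtain ⟨ω, hω, hωg, η, hη, hωη, hδ⟩ := hlift _ ho
      rw [← hy, hδ, Hq_mk_eq_zero, mem_BOmC_succ]
      obtain ⟨θ, hθ, hθω⟩ := exists_piMap_eq (sub_mem hω hω'.1) (by rw [map_sub, hωg, sub_self])
      refine ⟨θ, hθ, piMap_injective ?_⟩
      rw [← nabla_piMap (e := e) (m := i), hθω, map_sub, (mem_ZC.1 hω').2, sub_zero, hωη]
  · obtain ⟨⟨ζ, hζ⟩, rfl⟩ := Submodule.Quotient.mk_surjective _ x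
    constructor
    · intro h
      rw [hpiH' ζ hζ (piMap_mem_ZC_iff.2 hζ), Hq_mk_eq_zero, mem_BC_succ] at h
      obtain ⟨ω', hω', hωζ⟩ := h
      have ho : ointMap ω' ∈ ZGC d e P Q i :=
        mem_ZGC.2 ⟨ointMap_mem_GCs hω', by
          rw [← ointMap_nabla (e := e) (m := i), hωζ, ointMap_piMap]⟩
      obtain ⟨ω, hω, hωg, η, hη, hωη, hδ⟩ := hlift _ ho
      refine ⟨_, hδ.trans ?_⟩
      rw [Hq_mk_eq_mk, mem_BOmC_succ]
      obtain ⟨θ, hθ, hθω⟩ := exists_piMap_eq (sub_mem hω hω') (by rw [map_sub, hωg, sub_self])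
      refine ⟨θ, hθ, piMap_injective ?_⟩
      rw [← nabla_piMap (e := e) (m := i), hθω, map_sub, hωη, hωζ, map_sub]
    · rintro ⟨y, hy⟩
      obtain ⟨⟨g, hg⟩, rfl⟩ := Submodule.Quotient.mk_surjective _ y
      obtain ⟨ω, hω, -, η, hη, hωη, hδ⟩ := hlift g hg
      rw [← hy, hδ, hpiH' η hη (piMap_mem_ZC_iff.2 hη), Hq_mk_eq_zero, mem_BC_succ]
      exact ⟨ω, hω, hωη⟩

end IG

end
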